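/- arXiv:1601.03723 — 8 statements merged into one kernel-verified Lean document; each statement's English description precedes it below -/
import Mathlib

section
/- Let α ≥ 3/4 be a real number and γ = √(α(4α−3)). Then for every real x, 3Ψ₁(x) + 4Ψ₂(x) ≥ 0. -/
/-- The quartic `Ψ₁` from the curvature obstruction argument. -/
noncomputable def Psi1 (α γ x : ℝ) : ℝ :=
  (5 * α + 2 * γ) / (48 * α ^ 2) * x ^ 4
    + (2 * α - γ) / (24 * Real.sqrt 3 * α ^ 2) * x ^ 3
    - (α + γ) / (8 * α ^ 2) * x ^ 2
    + (2 * α + γ) / (8 * Real.sqrt 3 * α ^ 2) * x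
    - 1 / (16 * α)

/-- The quartic `Ψ₂` from the curvature obstruction argument. -/
noncomputable def Psi2 (α γ x : ℝ) : ℝ :=
  (3 * α ^ 2 - α - 2 * γ) / (48 * α ^ 2) * x ^ 4
    + (2 * α ^ 2 - 3 * α + γ) / (8 * Real.sqrt 3 * α ^ 2) * x ^ 3
    + (9 - 2 * α) / (48 * α) * x ^ 2
    - 1 / (4 * Real.sqrt 3) * x
    + 1 / 16

/-- For `α ≥ 3/4` and `γ = √(α(4α−3))`, the quartic `3Ψ₁ + 4Ψ₂` is
non-negative on all of `ℝ`. -/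
theorem three_psi1_add_four_psi2_nonneg (α : ℝ) (hα : 3 / 4 ≤ α)
    (γ : ℝ) (hγ : γ = Real.sqrt (α * (4 * α - 3))) :
    ∀ x : ℝ, 0 ≤ 3 * Psi1 α γ x + 4 * Psi2 α γ x := by
  intro x
  have ha : 0 < α := by linarith
  have hg0 : 0 ≤ γ := by rw [hγ]; exact Real.sqrt_nonneg _
  have hg2 : γ ^ 2 = α * (4 * α - 3) := by
    rw [hγ]; exact Real.sq_sqrt (mul_nonneg ha.le (by linarith))
  have hs0 : 0 < Real.sqrt 3 := Real.sqrt_pos.mpr (by norm_num)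
  have hs2 : Real.sqrt 3 ^ 2 = 3 := Real.sq_sqrt (by norm_num)
  unfold Psi1 Psi2
  generalize Real.sqrt 3 = s at hs0 hs2
  clear hγ
  obtain ⟨t, rfl⟩ : ∃ t, x = t / s := ⟨x * s, by field_simp⟩
  have hs3 : s ^ 3 = 3 * s := by rw [pow_succ, hs2]
  have hs4 : s ^ 4 = 9 := by
    have : s ^ 4 = (s ^ 2) ^ 2 := by ring
    rw [this, hs2]; norm_num
  have hR : 0 ≤ (2 * γ + 5 * α) * t ^ 2 - 6 * (α + γ) * t + 9 * α := by
    have hp : 0 < 2 * γ + 5 * α := by linarith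
    have h : (2 * γ + 5 * α) * ((2 * γ + 5 * α) * t ^ 2 - 6 * (α + γ) * t + 9 * α)
        = ((2 * γ + 5 * α) * t - 3 * (α + γ)) ^ 2 + 27 * α := by
      linear_combination (-9) * hg2
    refine nonneg_of_mul_nonneg_right (a := 2 * γ + 5 * α) ?_ hp
    rw [h]; positivity
  have e1 : (t / s) ^ 4 = t ^ 4 / 9 := by rw [div_pow, hs4]
  have e2 : (t / s) ^ 3 = t ^ 3 / (3 * s) := by rw [div_pow, hs3]
  have e3 : (t / s) ^ 2 = t ^ 2 / 3 := by rw [div_pow, hs2]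
  have key : 3 * ((5 * α + 2 * γ) / (48 * α ^ 2) * (t / s) ^ 4
      + (2 * α - γ) / (24 * s * α ^ 2) * (t / s) ^ 3
      - (α + γ) / (8 * α ^ 2) * (t / s) ^ 2
      + (2 * α + γ) / (8 * s * α ^ 2) * (t / s)
      - 1 / (16 * α)) + 4 * ((3 * α ^ 2 - α - 2 * γ) / (48 * α ^ 2) * (t / s) ^ 4
      + (2 * α ^ 2 - 3 * α + γ) / (8 * s * α ^ 2) * (t / s) ^ 3
      + (9 - 2 * α) / (48 * α) * (t / s) ^ 2
      - 1 / (4 * s) * (t / s)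
      + 1 / 16) = ((12 * α ^ 2 + 11 * α - 2 * γ) * t ^ 4
        + (48 * α ^ 2 - 60 * α + 18 * γ) * t ^ 3
        + 3 * (18 * α - 18 * γ - 8 * α ^ 2) * t ^ 2
        + 3 * (36 * α + 18 * γ - 48 * α ^ 2) * t + 9 * (12 * α ^ 2 - 9 * α)) / (432 * α ^ 2) := by
    have f2 : ∀ c d : ℝ, c / (d * s * α ^ 2) * (t ^ 3 / (3 * s)) = c / (9 * d * α ^ 2) * t ^ 3 := by
      intro c d
      rw [div_mul_div_comm, show d * s * α ^ 2 * (3 * s) = 3 * d * α ^ 2 * s ^ 2 by ring, hs2]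
      ring
    have f1 : ∀ c d : ℝ, c / (d * s * α ^ 2) * (t / s) = c / (3 * d * α ^ 2) * t := by
      intro c d
      rw [div_mul_div_comm, show d * s * α ^ 2 * s = d * α ^ 2 * s ^ 2 by ring, hs2]
      ring
    have f0 : 1 / (4 * s) * (t / s) = t / 12 := by
      rw [div_mul_div_comm, show 4 * s * s = 4 * s ^ 2 by ring, hs2]
      ring
    rw [e1, e2, e3, f2, f2, f1, f0]
    field_simp
    ring
  rw [key]
  have hP : 3 * α * ((12 * α ^ 2 + 11 * α - 2 * γ) * t ^ 4
        + (48 * α ^ 2 - 60 * α + 18 * γ) * t ^ 3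
        + 3 * (18 * α - 18 * γ - 8 * α ^ 2) * t ^ 2
        + 3 * (36 * α + 18 * γ - 48 * α ^ 2) * t + 9 * (12 * α ^ 2 - 9 * α))
      = ((4 * α - γ) * t + 3 * γ) ^ 2 *
        ((2 * γ + 5 * α) * t ^ 2 - 6 * (α + γ) * t + 9 * α) := by
    have hg3 : γ ^ 3 = γ * (α * (4 * α - 3)) := by rw [← hg2]; ring
    ring_nf
    rw [hg3, hg2]
    ring
  refine div_nonneg ?_ (by positivity)
  refine nonneg_of_mul_nonneg_right (a := 3 * α) ?_ (by positivity)
  rw [hP]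
  exact mul_nonneg (sq_nonneg _) hR
end

section
/- Let α ≥ 3/4 be a real number, γ = √(α(4α−3)), Ψ = 3Ψ₁ + 4Ψ₂, and x_α = √3(3 − 4α − 4γ)/(3 + 12α). Then Ψ(x_α) = 0, and Ψ(x) > 0 for every real x ≠ x_α; in particular x_α is the unique minimizer of Ψ. -/
lemma psi_factor (t y : ℝ) (h : 0 < 4 - t ^ 2) :
    3 * Psi1 (3 / (4 - t ^ 2)) (t * (3 / (4 - t ^ 2))) (Real.sqrt 3 * y)
      + 4 * Psi2 (3 / (4 - t ^ 2)) (t * (3 / (4 - t ^ 2))) (Real.sqrt 3 * y)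
      = 1 / 16 * (((4 - t) * y + t) ^ 2 * ((5 + 2 * t) * y ^ 2 - 2 * (t + 1) * y + 1)) := by
  have h0 : Real.sqrt 3 ≠ 0 := by positivity
  have h2 : Real.sqrt 3 ^ 2 = 3 := Real.sq_sqrt (by norm_num)
  have h4 : Real.sqrt 3 ^ 4 = 9 := by
    rw [show Real.sqrt 3 ^ 4 = (Real.sqrt 3 ^ 2) ^ 2 by ring, h2]; norm_num
  have h3 : Real.sqrt 3 ^ 3 = 3 * Real.sqrt 3 := by
    rw [show Real.sqrt 3 ^ 3 = (Real.sqrt 3 ^ 2) * Real.sqrt 3 by ring, h2]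
  have hs := h.ne'
  unfold Psi1 Psi2
  simp only [mul_pow, h2, h3, h4]
  field_simp
  ring

/-- For `α ≥ 3/4`, `γ = √(α(4α−3))` and
`x_α = √3(3 − 4α − 4γ)/(3 + 12α)`, the quartic `Ψ = 3Ψ₁ + 4Ψ₂` vanishes at
`x_α` and is strictly positive elsewhere; in particular `x_α` is the unique
minimizer of `Ψ`. -/
theorem psi_unique_minimizer (α : ℝ) (hα : 3 / 4 ≤ α)
    (γ : ℝ) (hγ : γ = Real.sqrt (α * (4 * α - 3)))
    (xα : ℝ) (hxα : xα = Real.sqrt 3 * (3 - 4 * α - 4 * γ) / (3 + 12 * α)) :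
    3 * Psi1 α γ xα + 4 * Psi2 α γ xα = 0 ∧
      ∀ x : ℝ, x ≠ xα → 0 < 3 * Psi1 α γ x + 4 * Psi2 α γ x := by
  have ha : 0 < α := by linarith
  have hg2 : γ ^ 2 = α * (4 * α - 3) := by
    rw [hγ]; exact Real.sq_sqrt (mul_nonneg ha.le (by linarith))
  have h0 : Real.sqrt 3 ≠ 0 := by positivity
  obtain ⟨t, ht⟩ : ∃ t, γ = t * α := ⟨γ / α, by field_simp⟩
  have hta : α * (4 - t ^ 2) = 3 := by
    apply mul_left_cancel₀ ha.ne'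
    rw [ht] at hg2
    linear_combination -hg2
  have h4 : 0 < 4 - t ^ 2 := by
    by_contra hh
    nlinarith [mul_nonneg ha.le (by linarith : (0:ℝ) ≤ t ^ 2 - 4)]
  have hae : α = 3 / (4 - t ^ 2) := by
    rw [eq_div_iff h4.ne']; exact hta
  have ht4 : 0 < 4 - t := by nlinarith
  have ht4' : 0 < 4 + t := by nlinarith
  have hx : xα = Real.sqrt 3 * (-t / (4 - t)) := by
    rw [hxα, ht, mul_div_assoc]
    congr 1
    rw [div_eq_div_iff (by positivity) ht4.ne']
    linear_combination (-4) * hta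
  clear hγ hxα hg2 hta
  have key : ∀ y : ℝ, 3 * Psi1 α γ (Real.sqrt 3 * y) + 4 * Psi2 α γ (Real.sqrt 3 * y)
      = 1 / 16 * (((4 - t) * y + t) ^ 2 * ((5 + 2 * t) * y ^ 2 - 2 * (t + 1) * y + 1)) := by
    intro y
    rw [ht, hae]
    exact psi_factor t y h4
  constructor
  · rw [hx, key]
    have : (4 - t) * (-t / (4 - t)) + t = 0 := by field_simp; ring
    rw [this]; ring
  · intro x hne
    obtain ⟨y, rfl⟩ : ∃ y, x = Real.sqrt 3 * y := ⟨x / Real.sqrt 3, by field_simp⟩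
    rw [key]
    have h1 : (4 - t) * y + t ≠ 0 := by
      intro h
      apply hne
      rw [hx]
      congr 1
      rw [eq_div_iff ht4.ne']
      linarith
    have h5 : 0 < 5 + 2 * t := by nlinarith
    have h6 : 0 < (5 + 2 * t) * y ^ 2 - 2 * (t + 1) * y + 1 := by
      have : 0 < (5 + 2 * t) * ((5 + 2 * t) * y ^ 2 - 2 * (t + 1) * y + 1) := by
        nlinarith [sq_nonneg ((5 + 2 * t) * y - (t + 1))]
      exact pos_of_mul_pos_right this h5.le
    positivity
end

section
/- Let α ≥ 3/4 be a real number, γ = √(α(4α−3)), and x_α = √3(3 − 4α − 4γ)/(3 + 12α). Then Ψ₂(x_α) = (16α − 9)(9 − 312α + 656α² − 48γ + 320αγ) / (36α(1 + 4α)⁴), and Ψ₂(x_α) > 0. -/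
/-- For `α ≥ 3/4`, `γ = √(α(4α−3))` and `x_α = √3(3 − 4α − 4γ)/(3 + 12α)`,
one has the closed formula
`Ψ₂(x_α) = (16α − 9)(9 − 312α + 656α² − 48γ + 320αγ)/(36α(1+4α)⁴)`,
and this value is strictly positive. -/
theorem psi2_at_xalpha (α : ℝ) (hα : 3 / 4 ≤ α)
    (γ : ℝ) (hγ : γ = Real.sqrt (α * (4 * α - 3)))
    (xα : ℝ) (hxα : xα = Real.sqrt 3 * (3 - 4 * α - 4 * γ) / (3 + 12 * α)) :
    Psi2 α γ xα =
      (16 * α - 9) * (9 - 312 * α + 656 * α ^ 2 - 48 * γ + 320 * α * γ) /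
        (36 * α * (1 + 4 * α) ^ 4) ∧
    0 < Psi2 α γ xα := by
  have hα0 : 0 < α := by linarith
  have hγ0 : 0 ≤ γ := by rw [hγ]; exact Real.sqrt_nonneg _
  have hγ2 : γ ^ 2 = α * (4 * α - 3) := by
    rw [hγ]; exact Real.sq_sqrt (mul_nonneg hα0.le (by linarith))
  have h1 : 0 < 1 + 4 * α := by linarith
  have key : Psi2 α γ xα =
      (16 * α - 9) * (9 - 312 * α + 656 * α ^ 2 - 48 * γ + 320 * α * γ) /
        (36 * α * (1 + 4 * α) ^ 4) := by
    have hs0 : 0 < Real.sqrt 3 := Real.sqrt_pos.mpr (by norm_num)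
    have hs2 : Real.sqrt 3 ^ 2 = 3 := Real.sq_sqrt (by norm_num)
    unfold Psi2
    generalize Real.sqrt 3 = s at *
    obtain ⟨y, hy⟩ : ∃ y, y = (3 - 4 * α - 4 * γ) / (1 + 4 * α) := ⟨_, rfl⟩
    have hx : xα = s * y / 3 := by
      rw [hxα, hy]
      have : 3 + 12 * α = 3 * (1 + 4 * α) := by ring
      rw [this]; field_simp
    have e4 : xα ^ 4 = y ^ 4 / 9 := by
      rw [hx]
      have : (s * y / 3) ^ 4 = (s ^ 2) ^ 2 * y ^ 4 / 81 := by ring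
      rw [this, hs2]; ring
    have e3 : (2 * α ^ 2 - 3 * α + γ) / (8 * s * α ^ 2) * xα ^ 3
        = (2 * α ^ 2 - 3 * α + γ) / (8 * α ^ 2) * (y ^ 3 / 9) := by
      have : xα ^ 3 = s * (y ^ 3 / 9) := by
        rw [hx]
        have : (s * y / 3) ^ 3 = s ^ 2 * s * y ^ 3 / 27 := by ring
        rw [this, hs2]; ring
      rw [this]; field_simp
    have e2 : xα ^ 2 = y ^ 2 / 3 := by
      rw [hx]
      have : (s * y / 3) ^ 2 = s ^ 2 * y ^ 2 / 9 := by ring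
      rw [this, hs2]; ring
    have e1 : 1 / (4 * s) * xα = y / 12 := by
      rw [hx]; field_simp; ring
    rw [e4, e3, e2, e1, hy]
    have g3 : γ ^ 3 = α * (4 * α - 3) * γ := by rw [← hγ2]; ring
    have g4 : γ ^ 4 = (α * (4 * α - 3)) ^ 2 := by rw [← hγ2]; ring
    have g5 : γ ^ 5 = (α * (4 * α - 3)) ^ 2 * γ := by rw [← hγ2]; ring
    field_simp
    ring_nf
    rw [g5, g4, g3, hγ2]
    ring
  refine ⟨key, ?_⟩
  rw [key]
  have : 0 < 9 - 312 * α + 656 * α ^ 2 - 48 * γ + 320 * α * γ := by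
    nlinarith [mul_nonneg (sub_nonneg.2 hα) hγ0, mul_nonneg (sub_nonneg.2 hα) (sub_nonneg.2 hα)]
  have : 0 < 16 * α - 9 := by linarith
  positivity
end

section
/- Let α ≥ 3/4 be a real number, γ = √(α(4α−3)), Ψ = 3Ψ₁ + 4Ψ₂, and x_α = √3(3 − 4α − 4γ)/(3 + 12α). Then for every real x, Ψ(x) = ((11α + 12α² − 2γ)/(48α²)) · (x − x_α)² · (x² − (2√3(2 − α + γ)/(4 + 3α)) x + 3α/(5α + 2γ)). -/
/-- Factorization of `Ψ = 3Ψ₁ + 4Ψ₂` with the double root `x_α` split off: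
`Ψ(x) = ((11α + 12α² − 2γ)/(48α²)) (x − x_α)² (x² − (2√3(2 − α + γ)/(4 + 3α)) x + 3α/(5α + 2γ))`. -/
theorem psi_factorization (α : ℝ) (hα : 3 / 4 ≤ α)
    (γ : ℝ) (hγ : γ = Real.sqrt (α * (4 * α - 3)))
    (xα : ℝ) (hxα : xα = Real.sqrt 3 * (3 - 4 * α - 4 * γ) / (3 + 12 * α)) :
    ∀ x : ℝ, 3 * Psi1 α γ x + 4 * Psi2 α γ x =
      (11 * α + 12 * α ^ 2 - 2 * γ) / (48 * α ^ 2) * (x - xα) ^ 2 *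
        (x ^ 2 - 2 * Real.sqrt 3 * (2 - α + γ) / (4 + 3 * α) * x
          + 3 * α / (5 * α + 2 * γ)) := by
  intro x
  have ha : 0 < α := by linarith
  have hg0 : 0 ≤ γ := hγ ▸ Real.sqrt_nonneg _
  have hg2 : γ ^ 2 = 4 * α ^ 2 - 3 * α := by
    rw [hγ, Real.sq_sqrt (mul_nonneg ha.le (by linarith))]; ring
  have hg3 : γ ^ 3 = (4 * α ^ 2 - 3 * α) * γ := by rw [← hg2]; ring
  have hg4 : γ ^ 4 = (4 * α ^ 2 - 3 * α) ^ 2 := by rw [← hg2]; ring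
  have hs : 0 < Real.sqrt 3 := by positivity
  have hs2 : Real.sqrt 3 ^ 2 = 3 := Real.sq_sqrt (by norm_num)
  clear hγ
  unfold Psi1 Psi2
  generalize Real.sqrt 3 = s at *
  obtain ⟨y, rfl⟩ : ∃ y, x = s * y := ⟨x / s, by field_simp⟩
  have hs4 : s ^ 4 = 9 := by rw [show s ^ 4 = (s ^ 2) ^ 2 by ring, hs2]; norm_num
  have h1 : 4 + 3 * α ≠ 0 := by positivity
  have h2 : 3 + 12 * α ≠ 0 := by positivity
  have h2' : 1 + 4 * α ≠ 0 := by positivity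
  have h3 : 5 * α + 2 * γ ≠ 0 := by positivity
  have hC : 3 * α / (5 * α + 2 * γ) = (5 * α - 2 * γ) / (4 + 3 * α) := by
    rw [div_eq_div_iff h3 h1]; linear_combination 4 * hg2
  have hL : 3 * ((5 * α + 2 * γ) / (48 * α ^ 2) * (s * y) ^ 4
    + (2 * α - γ) / (24 * s * α ^ 2) * (s * y) ^ 3
    - (α + γ) / (8 * α ^ 2) * (s * y) ^ 2
    + (2 * α + γ) / (8 * s * α ^ 2) * (s * y)
    - 1 / (16 * α)) + 4 * ((3 * α ^ 2 - α - 2 * γ) / (48 * α ^ 2) * (s * y) ^ 4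
    + (2 * α ^ 2 - 3 * α + γ) / (8 * s * α ^ 2) * (s * y) ^ 3
    + (9 - 2 * α) / (48 * α) * (s * y) ^ 2
    - 1 / (4 * s) * (s * y)
    + 1 / 16) = 3 * ((5 * α + 2 * γ) / (48 * α ^ 2) * (9 * y ^ 4)
    + (2 * α - γ) / (24 * α ^ 2) * (3 * y ^ 3)
    - (α + γ) / (8 * α ^ 2) * (3 * y ^ 2)
    + (2 * α + γ) / (8 * α ^ 2) * y
    - 1 / (16 * α)) + 4 * ((3 * α ^ 2 - α - 2 * γ) / (48 * α ^ 2) * (9 * y ^ 4)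
    + (2 * α ^ 2 - 3 * α + γ) / (8 * α ^ 2) * (3 * y ^ 3)
    + (9 - 2 * α) / (48 * α) * (3 * y ^ 2)
    - 1 / 4 * y
    + 1 / 16) := by
    rw [← hs4, ← hs2]; field_simp
  have hR1 : (s * y - xα) ^ 2 = 3 * (y - (3 - 4 * α - 4 * γ) / (3 + 12 * α)) ^ 2 := by
    rw [hxα, ← hs2]; ring
  have hR2 : (s * y) ^ 2 - 2 * s * (2 - α + γ) / (4 + 3 * α) * (s * y)
      = 3 * y ^ 2 - 6 * (2 - α + γ) / (4 + 3 * α) * y := by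
    linear_combination (y ^ 2 - 2 * (2 - α + γ) / (4 + 3 * α) * y) * hs2
  rw [hL, hR1, hR2, hC]
  have h2e : 3 + 12 * α = 3 * (1 + 4 * α) := by ring
  rw [h2e]
  field_simp
  ring_nf
  simp only [hg2, hg3, hg4]
  ring
end

section
/- Let α ≥ 3/4 be a real number and γ = √(α(4α−3)). Then the discriminant of the quadratic x² − (2√3(2 − α + γ)/(4 + 3α)) x + 3α/(5α + 2γ) satisfies (2√3(2 − α + γ)/(4 + 3α))² − 4·(3α/(5α + 2γ)) = 36/(12 − 41α − 20γ), and this quantity is negative. -/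
/-- For `α ≥ 3/4` and `γ = √(α(4α−3))`, the discriminant of the residual
quadratic `x² − (2√3(2 − α + γ)/(4 + 3α)) x + 3α/(5α + 2γ)` equals
`36/(12 − 41α − 20γ)` and is negative. -/
theorem residual_quadratic_discriminant (α : ℝ) (hα : 3 / 4 ≤ α)
    (γ : ℝ) (hγ : γ = Real.sqrt (α * (4 * α - 3))) :
    (2 * Real.sqrt 3 * (2 - α + γ) / (4 + 3 * α)) ^ 2
        - 4 * (3 * α / (5 * α + 2 * γ)) = 36 / (12 - 41 * α - 20 * γ) ∧
      (2 * Real.sqrt 3 * (2 - α + γ) / (4 + 3 * α)) ^ 2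
        - 4 * (3 * α / (5 * α + 2 * γ)) < 0 := by
  have h2 : γ ^ 2 = 4 * α ^ 2 - 3 * α := by
    rw [hγ, Real.sq_sqrt (mul_nonneg (by linarith) (by linarith))]; ring
  have h0 : 0 ≤ γ := hγ ▸ Real.sqrt_nonneg _
  have h3 : Real.sqrt 3 ^ 2 = 3 := Real.sq_sqrt (by norm_num)
  clear hγ
  have hA : 4 + 3 * α ≠ 0 := by linarith
  have hB : 5 * α + 2 * γ ≠ 0 := by linarith
  have hC' : 12 - 41 * α - 20 * γ < 0 := by linarith
  have hC : 12 - 41 * α - 20 * γ ≠ 0 := hC'.ne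
  have key : (2 * Real.sqrt 3 * (2 - α + γ) / (4 + 3 * α)) ^ 2
        - 4 * (3 * α / (5 * α + 2 * γ)) = 36 / (12 - 41 * α - 20 * γ) := by
    rw [div_pow, mul_pow, mul_pow, h3, mul_div_assoc', div_sub_div _ _ (pow_ne_zero 2 hA) hB,
      div_eq_div_iff (mul_ne_zero (pow_ne_zero 2 hA) hB) hC]
    grind
  exact ⟨key, key ▸ div_neg_of_pos_of_neg (by norm_num) hC'⟩
end

section
/- Let α ≥ 3/4 be a real number, γ = √(α(4α−3)), and x_α = √3(3 − 4α − 4γ)/(3 + 12α). Then for every real k ≥ 3 and every real ℓ with 0 ≤ ℓ ≤ 2√6/3, one has Ψ₁(x_α) + (4/(k√6)) · ℓ · Ψ₂(x_α) < 0. -/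
/-- The final contradiction in the curvature obstruction: for `α ≥ 3/4`,
`γ = √(α(4α−3))`, `x_α = √3(3 − 4α − 4γ)/(3 + 12α)`, any real `k ≥ 3` and any
`ℓ ∈ [0, 2√6/3]`, one has `Ψ₁(x_α) + (4/(k√6)) ℓ Ψ₂(x_α) < 0`. -/
theorem psi_combination_neg (α : ℝ) (hα : 3 / 4 ≤ α)
    (γ : ℝ) (hγ : γ = Real.sqrt (α * (4 * α - 3)))
    (xα : ℝ) (hxα : xα = Real.sqrt 3 * (3 - 4 * α - 4 * γ) / (3 + 12 * α))
    (k : ℝ) (hk : 3 ≤ k) (ℓ : ℝ) (hℓ0 : 0 ≤ ℓ) (hℓ : ℓ ≤ 2 * Real.sqrt 6 / 3) :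
    Psi1 α γ xα + 4 / (k * Real.sqrt 6) * ℓ * Psi2 α γ xα < 0 := by
  have hα0 : 0 < α := by linarith
  have hγ0 : 0 ≤ γ := hγ ▸ Real.sqrt_nonneg _
  have hγ2 : γ ^ 2 = α * (4 * α - 3) := by
    rw [hγ]; exact Real.sq_sqrt (mul_nonneg hα0.le (by linarith))
  obtain ⟨t, ht⟩ : ∃ t, t = γ / α := ⟨_, rfl⟩
  have hγt : γ = t * α := by rw [ht]; field_simp
  have ht0 : 0 ≤ t := ht ▸ div_nonneg hγ0 hα0.le
  have e1 : t ^ 2 * α = 4 * α - 3 := by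
    have : α * (t ^ 2 * α) = α * (4 * α - 3) := by rw [← hγ2, hγt]; ring
    exact mul_left_cancel₀ hα0.ne' this
  have e2 : α * (4 - t ^ 2) = 3 := by linarith
  have h4 : 0 < 4 - t ^ 2 := by
    by_contra h
    nlinarith [mul_nonneg hα0.le (by linarith : 0 ≤ -(4 - t ^ 2))]
  have ht2 : t < 2 := by nlinarith
  have hα3 : α = 3 / (4 - t ^ 2) := by rw [eq_div_iff h4.ne']; exact e2
  have hs : Real.sqrt 3 ^ 2 = 3 := Real.sq_sqrt (by norm_num)
  have hs0 : 0 < Real.sqrt 3 := Real.sqrt_pos.mpr (by norm_num)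
  have h4t : 0 < 4 - t := by linarith
  have hx : xα = Real.sqrt 3 * (-t / (4 - t)) := by
    rw [hxα, hγt, mul_div_assoc]
    congr 1
    rw [div_eq_div_iff (by positivity) h4t.ne']
    linear_combination (-4) * e2
  obtain ⟨y, hy⟩ : ∃ y, y = -t / (4 - t) := ⟨_, rfl⟩
  rw [← hy] at hx
  have hs4 : Real.sqrt 3 ^ 4 = 9 := by
    rw [show (4 : ℕ) = 2 * 2 from rfl, pow_mul, hs]; norm_num
  have hinv : 1 / α = (4 - t ^ 2) / 3 := by rw [hα3]; simp
  have P1 : Psi1 α γ xα = (1 / α) * ((5 + 2 * t) / 48 * 9 * y ^ 4 + (2 - t) / 8 * y ^ 3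
      - 3 * (1 + t) / 8 * y ^ 2 + (2 + t) / 8 * y - 1 / 16) := by
    unfold Psi1
    rw [hx, hγt, mul_pow, mul_pow, mul_pow, hs4, hs, pow_succ (Real.sqrt 3) 2, hs]
    field_simp
    ring
  have P2 : Psi2 α γ xα = (3 - (1 + 2 * t) * (1 / α)) / 48 * 9 * y ^ 4
      + (2 + (t - 3) * (1 / α)) * 3 / 8 * y ^ 3
      + (9 * (1 / α) - 2) / 16 * y ^ 2 - y / 4 + 1 / 16 := by
    unfold Psi2
    rw [hx, hγt, mul_pow, mul_pow, mul_pow, hs4, hs, pow_succ (Real.sqrt 3) 2, hs]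
    field_simp
    ring
  have Q2 : Psi2 α γ xα = (4 - t ^ 2) ^ 2 * (4 + 3 * t ^ 2) / (4 * (4 - t) ^ 4) := by
    rw [P2, hinv, hy]
    field_simp
    ring
  have Q1 : Psi1 α γ xα = -(4 / 3) * Psi2 α γ xα := by
    rw [Q2, P1, hinv, hy]
    field_simp
    ring
  have pos : 0 < Psi2 α γ xα := by rw [Q2]; positivity
  have h6 : 0 < Real.sqrt 6 := Real.sqrt_pos.mpr (by norm_num)
  have hc : 4 / (k * Real.sqrt 6) * ℓ < 4 / 3 := by
    rw [div_mul_eq_mul_div, div_lt_iff₀ (by positivity)]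
    nlinarith [mul_le_mul_of_nonneg_right hk h6.le]
  rw [Q1]
  nlinarith [mul_pos (sub_pos.mpr hc) pos]
end

section
/- Let β₁ = 7√3/3 − 2√39/3 and β₂ = 1/√3, and for β ∈ (−1/√3, √3) define p(β) = ((√3β² + 2β − √3)(−9β⁶ + 30√3β⁵ + 183β⁴ − 4√3β³ − 183β² + 30√3β + 9)) / (48(√3β² − 2β − √3)³). Then for every β ∈ (−1/√3, √3), if p(β) ≥ 0 then β₁ ≤ β ≤ β₂. -/
/-- For `β ∈ (−1/√3, √3)`, non-negativity of the curvature quantity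
`p(β)` forces `β₁ ≤ β ≤ β₂`, where `β₁ = 7√3/3 − 2√39/3` and `β₂ = 1/√3`. -/
theorem p_nonneg_implies_beta_range (β : ℝ)
    (h1 : -(1 / Real.sqrt 3) < β) (h2 : β < Real.sqrt 3)
    (hp : 0 ≤ (Real.sqrt 3 * β ^ 2 + 2 * β - Real.sqrt 3) *
        (-9 * β ^ 6 + 30 * Real.sqrt 3 * β ^ 5 + 183 * β ^ 4
          - 4 * Real.sqrt 3 * β ^ 3 - 183 * β ^ 2 + 30 * Real.sqrt 3 * β + 9) /
        (48 * (Real.sqrt 3 * β ^ 2 - 2 * β - Real.sqrt 3) ^ 3)) :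
    7 * Real.sqrt 3 / 3 - 2 * Real.sqrt 39 / 3 ≤ β ∧ β ≤ 1 / Real.sqrt 3 := by
  have hs : 0 < Real.sqrt 3 := by positivity
  have hs2 : Real.sqrt 3 ^ 2 = 3 := Real.sq_sqrt (by norm_num)
  have ht : 0 < Real.sqrt 13 := by positivity
  have ht2 : Real.sqrt 13 ^ 2 = 13 := Real.sq_sqrt (by norm_num)
  have h39 : Real.sqrt 39 = Real.sqrt 3 * Real.sqrt 13 := by
    rw [← Real.sqrt_mul (by norm_num)]; norm_num
  rw [h39]
  have hinv : 1 / Real.sqrt 3 = Real.sqrt 3 * (1 / 3) := by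
    field_simp; linarith
  rw [hinv] at h1 ⊢
  generalize Real.sqrt 3 = s at *
  generalize Real.sqrt 13 = t at *
  obtain ⟨x, rfl⟩ : ∃ x, β = s * x := ⟨β / s, by field_simp⟩
  have hx1 : -(1 / 3) < x := by
    by_contra h; push Not at h
    nlinarith
  have hx2 : x < 1 := by
    by_contra h; push Not at h
    nlinarith
  have hs4 : s ^ 4 = 9 := by rw [show s ^ 4 = (s ^ 2) ^ 2 by ring, hs2]; norm_num
  have hs6 : s ^ 6 = 27 := by rw [show s ^ 6 = (s ^ 2) ^ 3 by ring, hs2]; norm_num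
  have e1 : s * (s * x) ^ 2 + 2 * (s * x) - s = s * ((3 * x - 1) * (x + 1)) := by
    linear_combination s * x ^ 2 * hs2
  have e2 : s * (s * x) ^ 2 - 2 * (s * x) - s = -(s * ((3 * x + 1) * (1 - x))) := by
    linear_combination s * x ^ 2 * hs2
  have e3 : -9 * (s * x) ^ 6 + 30 * s * (s * x) ^ 5 + 183 * (s * x) ^ 4
      - 4 * s * (s * x) ^ 3 - 183 * (s * x) ^ 2 + 30 * s * (s * x) + 9
      = -(9 * ((3 * x ^ 2 - 14 * x - 1) * ((3 * x - 1) * (x + 1)) ^ 2)) := by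
    linear_combination (-9 * x ^ 6 + 30 * x ^ 5) * hs6 + (183 * x ^ 4 - 4 * x ^ 3) * hs4
      + (-183 * x ^ 2 + 30 * x) * hs2
  rw [e1, e2, e3] at hp
  have hD : 0 < s * ((3 * x + 1) * (1 - x)) :=
    mul_pos hs (mul_pos (by linarith) (by linarith))
  have hD3 := pow_pos hD 3
  have hx3 : 0 < x + 1 := by linarith
  have key : 0 ≤ (3 * x - 1) ^ 3 * (3 * x ^ 2 - 14 * x - 1) := by
    by_contra h
    push Not at h
    have hc : 0 < 9 * s * (x + 1) ^ 3 := by positivity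
    have h' := mul_neg_of_neg_of_pos h hc
    refine absurd hp (not_le.mpr ?_)
    have : s * ((3 * x - 1) * (x + 1)) *
        -(9 * ((3 * x ^ 2 - 14 * x - 1) * ((3 * x - 1) * (x + 1)) ^ 2)) /
        (48 * (-(s * ((3 * x + 1) * (1 - x)))) ^ 3)
        = ((3 * x - 1) ^ 3 * (3 * x ^ 2 - 14 * x - 1) * (9 * s * (x + 1) ^ 3)) /
          (48 * (s * ((3 * x + 1) * (1 - x))) ^ 3) := by
      rw [← neg_div_neg_eq]
      congr 1 <;> ring
    rw [this]
    exact div_neg_of_neg_of_pos h' (by positivity)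
  have ht3 : 3 < t := by nlinarith
  have ht4 : t < 4 := by nlinarith
  have hq : 3 * x ^ 2 - 14 * x - 1 = 3 * (x - (7 - 2 * t) / 3) * (x - (7 + 2 * t) / 3) := by
    linear_combination (4 / 3) * ht2
  have hneg : x - (7 + 2 * t) / 3 < 0 := by linarith
  have hB : (7 - 2 * t) / 3 ≤ x := by
    by_contra h
    push Not at h
    have a : 0 < 3 * x ^ 2 - 14 * x - 1 := by
      rw [hq]; exact mul_pos_of_neg_of_neg (by linarith) hneg
    have b : (3 * x - 1) ^ 3 < 0 := Odd.pow_neg (by decide) (by linarith)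
    linarith [mul_neg_of_neg_of_pos b a]
  have hC : x ≤ 1 / 3 := by
    by_contra h
    push Not at h
    have a : 3 * x ^ 2 - 14 * x - 1 < 0 := by
      rw [hq]; exact mul_neg_of_pos_of_neg (by linarith) hneg
    have b : 0 < (3 * x - 1) ^ 3 := pow_pos (by linarith) 3
    linarith [mul_neg_of_pos_of_neg b a]
  constructor
  · have := mul_le_mul_of_nonneg_left hB hs.le
    linarith
  · exact mul_le_mul_of_nonneg_left hC hs.le
end

section
/- Let L > 0 and let f₁, f₂, f₁₂, ξ : ℝ → ℝ satisfy: f₁ and f₁₂ are differentiable at 0 with f₁(0) = 0, f₁′(0) > 0, f₁₂(0) = 0, f₁₂′(0) = 0; f₂ is continuous at 0 with f₂(0) > 0; for all t ∈ (0, L), f₁(t) > 0, ξ(t) > 0, f₁(t)²f₂(t)² − f₁₂(t)² > 0; ξ is differentiable on (0, L) with ξ′(t) ≥ 0; and for all t ∈ (0, L), (ξ′(t))² ≤ (8/3) · ((f₁(t)² + f₂(t)² + 2f₁₂(t)) / (f₁(t)²f₂(t)² − f₁₂(t)²)) · (ξ(t))². Then limsup_{t → 0⁺} (f₁(t) ξ′(t)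 / ξ(t)) ≤ 2√6/3. -/
/-- The analytic lemma bounding `limsup_{t→0⁺} f₁ ξ′ / ξ` by `2√6/3` under the
differential inequality `(ξ′)² ≤ (8/3)((f₁² + f₂² + 2f₁₂)/(f₁²f₂² − f₁₂²)) ξ²`
on `(0, L)`, given the boundary behaviour of `f₁, f₂, f₁₂, ξ` at `0`. -/
theorem limsup_f1_xi_ratio_le (L : ℝ) (hL : 0 < L)
    (f₁ f₂ f₁₂ ξ ξd : ℝ → ℝ)
    (hf₁diff : DifferentiableAt ℝ f₁ 0) (hf₁0 : f₁ 0 = 0)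
    (hf₁' : 0 < deriv f₁ 0)
    (hf₁₂diff : DifferentiableAt ℝ f₁₂ 0) (hf₁₂0 : f₁₂ 0 = 0)
    (hf₁₂' : deriv f₁₂ 0 = 0)
    (hf₂cont : ContinuousAt f₂ 0) (hf₂0 : 0 < f₂ 0)
    (hf₁pos : ∀ t ∈ Set.Ioo 0 L, 0 < f₁ t)
    (hξpos : ∀ t ∈ Set.Ioo 0 L, 0 < ξ t)
    (hdet : ∀ t ∈ Set.Ioo 0 L, 0 < f₁ t ^ 2 * f₂ t ^ 2 - f₁₂ t ^ 2)
    (hξderiv : ∀ t ∈ Set.Ioo 0 L, HasDerivAt ξ (ξd t) t)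
    (hξd : ∀ t ∈ Set.Ioo 0 L, 0 ≤ ξd t)
    (hineq : ∀ t ∈ Set.Ioo 0 L, ξd t ^ 2 ≤
      8 / 3 * ((f₁ t ^ 2 + f₂ t ^ 2 + 2 * f₁₂ t) /
        (f₁ t ^ 2 * f₂ t ^ 2 - f₁₂ t ^ 2)) * ξ t ^ 2) :
    Filter.limsup (fun t => f₁ t * ξd t / ξ t) (nhdsWithin 0 (Set.Ioi 0))
      ≤ 2 * Real.sqrt 6 / 3 := by
  have hm : Set.Ioo 0 L ∈ nhdsWithin (0:ℝ) (Set.Ioi 0) := Ioo_mem_nhdsGT hL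
  have slope_lim : ∀ g : ℝ → ℝ, DifferentiableAt ℝ g 0 → g 0 = 0 →
      Filter.Tendsto (fun t => t⁻¹ * g t) (nhdsWithin 0 (Set.Ioi 0)) (nhds (deriv g 0)) := by
    intro g hg h0
    have h := (hasDerivAt_iff_tendsto_slope_zero.1 hg.hasDerivAt).mono_left
      (nhdsWithin_mono (0:ℝ) (fun x (hx : x ∈ Set.Ioi (0:ℝ)) => ne_of_gt hx))
    simpa [h0] using h
  have hr : Filter.Tendsto (fun t => f₁₂ t / f₁ t) (nhdsWithin 0 (Set.Ioi 0)) (nhds 0) := by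
    have h := (slope_lim f₁₂ hf₁₂diff hf₁₂0).div (slope_lim f₁ hf₁diff hf₁0) hf₁'.ne'
    rw [hf₁₂', zero_div] at h
    refine h.congr' ?_
    filter_upwards [hm] with t ht
    have := ht.1.ne'
    have := (hf₁pos t ht).ne'
    simp only [Pi.div_apply]
    field_simp
  have c1 : Filter.Tendsto f₁ (nhdsWithin 0 (Set.Ioi 0)) (nhds 0) := by
    have := hf₁diff.continuousAt.tendsto.mono_left (nhdsWithin_le_nhds (s := Set.Ioi 0))
    rwa [hf₁0] at this
  have c12 : Filter.Tendsto f₁₂ (nhdsWithin 0 (Set.Ioi 0)) (nhds 0) := by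
    have := hf₁₂diff.continuousAt.tendsto.mono_left (nhdsWithin_le_nhds (s := Set.Ioi 0))
    rwa [hf₁₂0] at this
  have c2 : Filter.Tendsto f₂ (nhdsWithin 0 (Set.Ioi 0)) (nhds (f₂ 0)) :=
    hf₂cont.tendsto.mono_left nhdsWithin_le_nhds
  have hG : Filter.Tendsto (fun t => Real.sqrt (8 / 3 * ((f₁ t ^ 2 + f₂ t ^ 2 + 2 * f₁₂ t) /
        (f₂ t ^ 2 - (f₁₂ t / f₁ t) ^ 2)))) (nhdsWithin 0 (Set.Ioi 0))
        (nhds (2 * Real.sqrt 6 / 3)) := by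
    have h := (((((c1.pow 2).add (c2.pow 2)).add (c12.const_mul 2)).div
      ((c2.pow 2).sub (hr.pow 2)) (by simpa using hf₂0.ne')).const_mul (8/3)).sqrt
    have e : (8 / 3 * ((0 ^ 2 + f₂ 0 ^ 2 + 2 * 0) / (f₂ 0 ^ 2 - 0 ^ 2)) : ℝ) = 8 / 3 := by
      have := hf₂0.ne'
      field_simp
      ring
    have e2 : Real.sqrt (8 / 3) = 2 * Real.sqrt 6 / 3 := by
      rw [Real.sqrt_eq_iff_mul_self_eq_of_pos (by positivity)]
      have := Real.mul_self_sqrt (show (0:ℝ) ≤ 6 by norm_num)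
      linear_combination (4/9) * this
    rw [e, e2] at h
    exact h
  rw [← hG.limsup_eq]
  refine Filter.limsup_le_limsup ?_ ?_ hG.isBoundedUnder_le
  · filter_upwards [hm] with t ht
    apply Real.le_sqrt_of_sq_le
    have p1 := hf₁pos t ht
    have p2 := hξpos t ht
    have hd := hdet t ht
    have e : f₁ t ^ 2 * f₂ t ^ 2 - f₁₂ t ^ 2
        = f₁ t ^ 2 * (f₂ t ^ 2 - (f₁₂ t / f₁ t) ^ 2) := by
      field_simp
    have hi := hineq t ht
    rw [e] at hi hd
    have hD := pos_of_mul_pos_right hd (by positivity)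
    rw [div_pow, div_le_iff₀ (by positivity), mul_pow]
    generalize f₂ t ^ 2 - (f₁₂ t / f₁ t) ^ 2 = D at *
    calc f₁ t ^ 2 * ξd t ^ 2 ≤ f₁ t ^ 2 * (8 / 3 * ((f₁ t ^ 2 + f₂ t ^ 2 + 2 * f₁₂ t) /
          (f₁ t ^ 2 * D)) * ξ t ^ 2) := by gcongr
      _ = _ := by field_simp
  · refine Filter.IsBoundedUnder.isCoboundedUnder_le ⟨0, ?_⟩
    rw [Filter.eventually_map]
    filter_upwards [hm] with t ht
    exact div_nonneg (mul_nonneg (hf₁pos t ht).le (hξd t ht)) (hξpos t ht).le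
end
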